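/- The Gauss hypergeometric series satisfies ₂F₁(1/6, 1/2; 5/6; 5/32) = (2/5) · 2^{1/6} · √3 · 5^{1/6}. -/

import Mathlib

open scoped Nat

/-- Pochhammer symbol (rising factorial) on the reals. -/
noncomputable def poch (a : ℝ) (n : ℕ) : ℝ := ∏ i ∈ Finset.range n, (a + i)

/-- Gauss hypergeometric series ₂F₁(a,b;c;x) as a real series. -/
noncomputable def twoFone (a b c x : ℝ) : ℝ :=
  ∑' n : ℕ, poch a n * poch b n / (poch c n * (n ! : ℝ)) * x ^ n

open MeasureTheory Set Filter Topology ProbabilityTheory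

lemma aux_beta {a b : ℝ} (ha : 0 < a) (hb : 0 < b) :
    ∫⁻ x in Ioo (0:ℝ) 1, ENNReal.ofReal (x ^ (a - 1) * (1 - x) ^ (b - 1))
      = ENNReal.ofReal (beta a b) := by
  have h := lintegral_betaPDF_eq_one ha hb
  rw [lintegral_betaPDF] at h
  have hp := beta_pos ha hb
  have e : ∀ x : ℝ, ENNReal.ofReal (1 / beta a b * x ^ (a - 1) * (1 - x) ^ (b - 1))
      = ENNReal.ofReal (1 / beta a b) * ENNReal.ofReal (x ^ (a - 1) * (1 - x) ^ (b - 1)) := by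
    intro x
    rw [← ENNReal.ofReal_mul (by positivity), mul_assoc]
  simp_rw [e] at h
  rw [lintegral_const_mul _ (by fun_prop)] at h
  calc _ = ENNReal.ofReal (beta a b) * (ENNReal.ofReal (1 / beta a b) *
        ∫⁻ x in Ioo (0:ℝ) 1, ENNReal.ofReal (x ^ (a - 1) * (1 - x) ^ (b - 1))) := by
        rw [← mul_assoc, ← ENNReal.ofReal_mul hp.le, mul_one_div_cancel hp.ne']
        simp
    _ = _ := by rw [h, mul_one]

lemma aux_cov (f f' : ℝ → ℝ) (hf : ∀ x ∈ Ioo (0:ℝ) 1, HasDerivAt f (f' x) x)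
    (hpos : ∀ x ∈ Ioo (0:ℝ) 1, 0 < f' x) (hbot : Tendsto f (𝓝[>] 0) atBot)
    (htop : Tendsto f (𝓝[<] 1) atTop) (g : ℝ → ENNReal) :
    ∫⁻ x, g x = ∫⁻ x in Ioo (0:ℝ) 1, ENNReal.ofReal (f' x) * g (f x) := by
  have hc : ContinuousOn f (Ioo 0 1) := fun x hx => (hf x hx).continuousAt.continuousWithinAt
  have hm : StrictMonoOn f (Ioo 0 1) := by
    apply strictMonoOn_of_deriv_pos (convex_Ioo 0 1) hc
    intro x hx
    rw [interior_Ioo] at hx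
    rw [(hf x hx).deriv]
    exact hpos x hx
  have him : f '' Ioo 0 1 = univ := by
    rw [eq_univ_iff_forall]
    intro y
    obtain ⟨p, hp1, hp2⟩ := ((hbot.eventually (eventually_le_atBot y)).and
      (Ioo_mem_nhdsGT (show (0:ℝ) < 1 by norm_num))).exists
    obtain ⟨q, hq1, hq2⟩ := ((htop.eventually (eventually_ge_atTop y)).and
      (Ioo_mem_nhdsLT (show (0:ℝ) < 1 by norm_num))).exists
    exact isPreconnected_Ioo.intermediate_value hp2 hq2 hc ⟨hp1, hq1⟩
  have := lintegral_image_eq_lintegral_abs_deriv_mul measurableSet_Ioo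
    (fun x hx => (hf x hx).hasDerivWithinAt) hm.injOn g
  rw [him, Measure.restrict_univ] at this
  rw [this]
  apply setLIntegral_congr_fun measurableSet_Ioo
  intro x hx
  simp only [abs_of_pos (hpos x hx)]

lemma poch_succ' (a : ℝ) (n : ℕ) : poch a (n+1) = poch a n * (a + n) := by
  simp [poch, Finset.prod_range_succ]

lemma poch_pos' {a : ℝ} (ha : 0 < a) (n : ℕ) : 0 < poch a n :=
  Finset.prod_pos fun i _ => by positivity

lemma aux_term (n : ℕ) : beta (1/2 + n) (1/3)
    = poch (1/2) n / poch (5/6) n * beta (1/2) (1/3) := by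
  induction n with
  | zero => simp [poch]
  | succ n ih =>
    have h1 : beta (1/2 + (n+1 : ℕ)) (1/3) = (1/2 + n) / (5/6 + n) * beta (1/2 + n) (1/3) := by
      unfold beta
      have e1 : (1/2 + ((n+1 : ℕ):ℝ)) = (1/2 + n) + 1 := by push_cast; ring
      have e2 : (1/2 + (n:ℝ)) + 1 + 1/3 = (5/6 + n) + 1 := by ring
      have e3 : (1/2 + (n:ℝ)) + 1/3 = (5/6 + n) := by ring
      rw [e1, e2, e3, Real.Gamma_add_one (by positivity), Real.Gamma_add_one (by positivity)]
      have := (Real.Gamma_pos_of_pos (show 0 < 5/6 + (n:ℝ) by positivity)).ne'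
      field_simp
    rw [h1, ih, poch_succ', poch_succ']
    have := (poch_pos' (show (0:ℝ) < 5/6 by norm_num) n).ne'
    field_simp

lemma aux_choose (a : ℝ) (n : ℕ) : Ring.choose (a + n - 1) n = poch a n / (n.factorial : ℝ) := by
  rw [← Ring.multichoose_eq]
  have h := Ring.factorial_nsmul_multichoose_eq_ascPochhammer a n
  rw [Polynomial.ascPochhammer_smeval_eq_eval] at h
  rw [eq_div_iff (by positivity), mul_comm, ← nsmul_eq_mul, h]
  clear h
  induction n with
  | zero => simp [poch]
  | succ n ih => rw [ascPochhammer_succ_eval, ih, poch_succ']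

lemma aux_binom {y : ℝ} (h0 : 0 ≤ y) (h1 : y < 1) :
    HasSum (fun n : ℕ => poch (1/6) n / (n.factorial : ℝ) * y ^ n) ((1 - y) ^ (-(1/6) : ℝ)) := by
  have h := (Real.one_div_one_sub_rpow_hasFPowerSeriesOnBall_zero (1/6)).hasSum
    (y := y) (by simp [enorm_eq_nnnorm, ← NNReal.coe_lt_coe, abs_of_nonneg h0, h1])
  simp only [zero_add, FormalMultilinearSeries.ofScalars_apply_eq, aux_choose, smul_eq_mul] at h
  rw [Real.rpow_neg (by linarith), ← one_div]
  exact h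

lemma aux_gamma : (4:ℝ) ^ (-(1/3) : ℝ) * beta (1/6) (1/6) = √3 * beta (1/2) (1/3) := by
  unfold beta
  have h1 := Real.Gamma_mul_Gamma_add_half (1/6)
  have h2 := Real.Gamma_mul_Gamma_one_sub (1/6)
  have h3 := Real.Gamma_mul_Gamma_one_sub (1/3)
  have s1 : Real.sin (Real.pi * (1/6)) = 1/2 := by rw [← Real.sin_pi_div_six]; congr 1; ring
  have s2 : Real.sin (Real.pi * (1/3)) = √3/2 := by rw [← Real.sin_pi_div_three]; congr 1; ring
  rw [s1] at h2
  rw [s2] at h3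
  norm_num [Real.Gamma_one_half_eq] at h1 h2 h3 ⊢
  have e : (4:ℝ) ^ (-(1/3) : ℝ) * 2 ^ (2/3:ℝ) = 1 := by
    rw [show (4:ℝ) = 2 ^ (2:ℝ) by norm_num, ← Real.rpow_mul (by norm_num),
      ← Real.rpow_add (by norm_num)]
    norm_num
  have p1 := Real.Gamma_pos_of_pos (show (0:ℝ) < 1/6 by norm_num)
  have p2 := Real.Gamma_pos_of_pos (show (0:ℝ) < 1/3 by norm_num)
  have p3 := Real.Gamma_pos_of_pos (show (0:ℝ) < 2/3 by norm_num)
  have p4 := Real.Gamma_pos_of_pos (show (0:ℝ) < 5/6 by norm_num)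
  have q3 : (0:ℝ) < √3 := by positivity
  have q4 : √3 * √3 = (3:ℝ) := Real.mul_self_sqrt (by norm_num)
  norm_num at e
  generalize (4:ℝ) ^ (-(1/3) : ℝ) = A at *
  generalize (2:ℝ) ^ (2/3 : ℝ) = B at *
  generalize Real.Gamma (1/6) = g1 at *
  generalize Real.Gamma (1/3) = g2 at *
  generalize Real.Gamma (2/3) = g4 at *
  generalize Real.Gamma (5/6) = g5 at *
  have h3' : √3 * (g2 * g4) = 2 * Real.pi := by rw [h3]; field_simp
  have key : g1 * g5 = √3 * (g2 * g4) := by rw [h3', h2]; ring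
  rw [← mul_div_assoc, ← mul_div_assoc, div_eq_div_iff p2.ne' p4.ne']
  have : g4 * (A * (g1 * g1) * g5) = g4 * (√3 * (√Real.pi * g2) * g2) := by
    linear_combination (A * g1 * g4) * key + (√3 * g2 * g4 * A) * h1 + (√3 * g2 * g4 * g2 * √Real.pi) * e
  exact mul_left_cancel₀ p3.ne' this

lemma aux_series :
    (∑' n : ℕ, ENNReal.ofReal
      (poch (1/6) n * poch (1/2) n / (poch (5/6) n * (n.factorial : ℝ)) * (5/32) ^ n))
      * ENNReal.ofReal (beta (1/2) (1/3))
    = ∫⁻ t in Ioo (0:ℝ) 1, ENNReal.ofReal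
      (t ^ (-(1/2) : ℝ) * (1 - t) ^ (-(2/3) : ℝ) * (1 - 5/32 * t) ^ (-(1/6) : ℝ)) := by
  have hp6 := fun n => poch_pos' (show (0:ℝ) < 1/6 by norm_num) n
  have hp2 := fun n => poch_pos' (show (0:ℝ) < 1/2 by norm_num) n
  have hp5 := fun n => poch_pos' (show (0:ℝ) < 5/6 by norm_num) n
  have h1 : ∫⁻ t in Ioo (0:ℝ) 1, ENNReal.ofReal
      (t ^ (-(1/2) : ℝ) * (1 - t) ^ (-(2/3) : ℝ) * (1 - 5/32 * t) ^ (-(1/6) : ℝ))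
      = ∫⁻ t in Ioo (0:ℝ) 1, ∑' n : ℕ,
        ENNReal.ofReal (poch (1/6) n / (n.factorial : ℝ) * (5/32) ^ n) *
        ENNReal.ofReal (t ^ ((1/2 + n : ℝ) - 1) * (1 - t) ^ ((1/3 : ℝ) - 1)) := by
    apply setLIntegral_congr_fun measurableSet_Ioo
    intro t ht
    have ht0 := ht.1
    have ht1 : 0 < 1 - t := by linarith [ht.2]
    have hs := (aux_binom (y := 5/32 * t) (by linarith) (by linarith)).mul_left
      (t ^ (-(1/2) : ℝ) * (1 - t) ^ (-(2/3) : ℝ))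
    simp only
    rw [← hs.tsum_eq, ENNReal.ofReal_tsum_of_nonneg _ hs.summable]
    · apply tsum_congr
      intro n
      have := hp6 n
      rw [← ENNReal.ofReal_mul (by positivity)]
      congr 1
      rw [show ((1/2 + n : ℝ) - 1) = -(1/2) + n by ring, Real.rpow_add ht0, Real.rpow_natCast,
        show ((1/3 : ℝ) - 1) = -(2/3) by norm_num, mul_pow]
      ring
    · intro n
      have := hp6 n
      positivity
  rw [h1, lintegral_tsum (fun n => by fun_prop), ← ENNReal.tsum_mul_right]
  apply tsum_congr
  intro n
  have := hp6 n
  have := hp2 n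
  have := hp5 n
  rw [lintegral_const_mul _ (by fun_prop), aux_beta (by positivity) (by norm_num), aux_term,
    ← ENNReal.ofReal_mul (by positivity), ← ENNReal.ofReal_mul (by positivity)]
  congr 1
  field_simp

lemma aux_pow_half {x : ℝ} (hx : 0 < x) : x ^ (-(1/2) : ℝ) = x * x ^ (-(3/2) : ℝ) := by
  rw [← Real.rpow_one_add' hx.le (by norm_num)]; norm_num

lemma aux_japan : ∫⁻ w : ℝ, ENNReal.ofReal ((1 + w ^ 2) ^ (-(2/3) : ℝ))
    = ENNReal.ofReal ((4:ℝ) ^ (-(1/3) : ℝ) * beta (1/6) (1/6)) := by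
  have t0 : Tendsto (fun y : ℝ => y ^ (-(1/2) : ℝ)) (𝓝[>] 0) atTop :=
    tendsto_rpow_neg_nhdsGT_zero (by norm_num)
  have t1 : Tendsto (fun y : ℝ => (1 - y) ^ (-(1/2) : ℝ)) (𝓝[<] 1) atTop := by
    apply t0.comp
    apply tendsto_nhdsWithin_iff.2 ⟨?_, ?_⟩
    · have : Tendsto (fun y : ℝ => 1 - y) (𝓝 1) (𝓝 (1 - 1)) := by
        apply Continuous.tendsto; fun_prop
      rw [sub_self] at this
      exact this.mono_left nhdsWithin_le_nhds
    · filter_upwards [self_mem_nhdsWithin] with y hy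
      simpa using hy
  rw [aux_cov (fun y => (y - 1/2) * y ^ (-(1/2) : ℝ) * (1 - y) ^ (-(1/2) : ℝ))
    (fun y => 1/4 * y ^ (-(3/2) : ℝ) * (1 - y) ^ (-(3/2) : ℝ)),
    ENNReal.ofReal_mul (by positivity), ← aux_beta (by norm_num) (by norm_num),
    ← lintegral_const_mul _ (by fun_prop)]
  · apply setLIntegral_congr_fun measurableSet_Ioo
    intro y hy
    have h0 := hy.1
    have h1 : 0 < 1 - y := by linarith [hy.2]
    simp only
    rw [← ENNReal.ofReal_mul (by positivity), ← ENNReal.ofReal_mul (by positivity)]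
    congr 1
    have e : 1 + ((y - 1/2) * y ^ (-(1/2) : ℝ) * (1 - y) ^ (-(1/2) : ℝ)) ^ 2
        = 4⁻¹ * (y ^ (-1 : ℝ) * (1 - y) ^ (-1 : ℝ)) := by
      rw [mul_pow, mul_pow, ← Real.rpow_mul_natCast h0.le, ← Real.rpow_mul_natCast h1.le]
      norm_num [Real.rpow_neg_one]
      field_simp
      ring
    rw [e, Real.mul_rpow (by norm_num) (by positivity), Real.mul_rpow (by positivity) (by positivity),
      ← Real.rpow_mul h0.le, ← Real.rpow_mul h1.le]
    have e4 : (1/4 : ℝ) * 4⁻¹ ^ (-(2/3) : ℝ) = 4 ^ (-(1/3) : ℝ) := by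
      rw [← Real.rpow_neg_one (4:ℝ), ← Real.rpow_mul (by norm_num), one_div, ← Real.rpow_neg_one (4:ℝ),
        ← Real.rpow_add (by norm_num)]
      norm_num
    have ey : ∀ z : ℝ, 0 < z → z ^ (-(3/2) : ℝ) * z ^ ((-1) * (-(2/3)) : ℝ) = z ^ ((1/6 : ℝ) - 1) := by
      intro z hz
      rw [← Real.rpow_add hz]; norm_num
    rw [← ey y h0, ← ey _ h1, ← e4]
    ring
  · intro y hy
    have h0 := hy.1
    have h1 : 0 < 1 - y := by linarith [hy.2]
    have d1 : HasDerivAt (fun y : ℝ => y ^ (-(1/2) : ℝ)) (-(1/2) * y ^ (-(3/2) : ℝ)) y := by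
      convert! Real.hasDerivAt_rpow_const (p := -(1/2)) (Or.inl h0.ne') using 2
      norm_num
    have d2 : HasDerivAt (fun y : ℝ => (1 - y) ^ (-(1/2) : ℝ)) (-1 * (-(1/2)) * (1 - y) ^ (-(3/2) : ℝ)) y := by
      convert! ((hasDerivAt_id y).const_sub 1).rpow_const (p := -(1/2)) (Or.inl h1.ne') using 2
      norm_num
    convert! (((hasDerivAt_id y).sub_const (1/2)).mul d1).mul d2 using 1
    simp only [id, Pi.mul_apply]
    rw [aux_pow_half h0, aux_pow_half h1]
    ring
  · intro y hy
    have h0 := hy.1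
    have h1 : 0 < 1 - y := by linarith [hy.2]
    positivity
  · have c : Tendsto (fun y : ℝ => (y - 1/2) * (1 - y) ^ (-(1/2) : ℝ)) (𝓝[>] 0)
        (𝓝 ((0 - 1/2) * (1 - 0) ^ (-(1/2) : ℝ))) := by
      apply Tendsto.mono_left _ nhdsWithin_le_nhds
      apply ContinuousAt.tendsto (f := fun y : ℝ => (y - 1/2) * (1 - y) ^ (-(1/2) : ℝ))
      fun_prop (disch := norm_num)
    refine (c.neg_mul_atTop (by norm_num) t0).congr fun y => by ring
  · have c : Tendsto (fun y : ℝ => (y - 1/2) * y ^ (-(1/2) : ℝ)) (𝓝[<] 1)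
        (𝓝 ((1 - 1/2) * 1 ^ (-(1/2) : ℝ))) := by
      apply Tendsto.mono_left _ nhdsWithin_le_nhds
      apply ContinuousAt.tendsto (f := fun y : ℝ => (y - 1/2) * y ^ (-(1/2) : ℝ))
      fun_prop (disch := norm_num)
    exact c.pos_mul_atTop (by norm_num) t1

lemma aux_P {t : ℝ} (h0 : 0 < t) (h1 : t < 1) :
    0 < 1 - 25/18 * t + 125/288 * t^2 + 625/2304 * t^3 := by
  nlinarith [mul_nonneg h0.le (sq_nonneg (t - 7/8)), sq_nonneg (t - 7/8), sq_nonneg (t-1)]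

lemma aux_main : ∫⁻ w : ℝ, ENNReal.ofReal ((1 + w ^ 2) ^ (-(2/3) : ℝ))
    = ENNReal.ofReal (81/25 * (√10)⁻¹ * (6^6/10^5) ^ (-(2/3) : ℝ)) *
      ∫⁻ t in Ioo (0:ℝ) 1, ENNReal.ofReal
      (t ^ (-(1/2) : ℝ) * (1 - t) ^ (-(2/3) : ℝ) * (1 - 5/32 * t) ^ (-(1/6) : ℝ)) := by
  have hK : ((√10)⁻¹)^2 = (1/10 : ℝ) := by
    rw [inv_pow, Real.sq_sqrt (by norm_num)]; norm_num
  have hKpos : 0 < (√10)⁻¹ := by positivity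
  generalize (√10)⁻¹ = K at *
  have t0 : Tendsto (fun y : ℝ => y ^ (-(3/2) : ℝ)) (𝓝[>] 0) atTop :=
    tendsto_rpow_neg_nhdsGT_zero (by norm_num)
  have t1 : Tendsto (fun y : ℝ => (1 - y)⁻¹) (𝓝[<] 1) atTop := by
    apply tendsto_inv_nhdsGT_zero.comp
    apply tendsto_nhdsWithin_iff.2 ⟨?_, ?_⟩
    · have : Tendsto (fun y : ℝ => 1 - y) (𝓝 1) (𝓝 (1 - 1)) := by
        apply Continuous.tendsto; fun_prop
      rw [sub_self] at this
      exact this.mono_left nhdsWithin_le_nhds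
    · filter_upwards [self_mem_nhdsWithin] with y hy
      simpa using hy
  rw [aux_cov (fun t => -K * (54/25 - 9/2 * t + 95/32 * t^2 - 525/256 * t^3 + 4125/4096 * t^4
        + 125/4096 * t^5) * t ^ (-(3/2) : ℝ) * (1 - t)⁻¹ * (1 - 5/32 * t) ^ (-(5/2) : ℝ))
    (fun t => 81/25 * K * (1 - 25/18 * t + 125/288 * t^2 + 625/2304 * t^3) ^ 2
      * t ^ (-(5/2) : ℝ) * ((1 - t)^2)⁻¹ * (1 - 5/32 * t) ^ (-(7/2) : ℝ)),
    ← lintegral_const_mul _ (by fun_prop)]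
  · apply setLIntegral_congr_fun measurableSet_Ioo
    intro t ht
    have h0 := ht.1
    have h1 : 0 < 1 - t := by linarith [ht.2]
    have h2 : 0 < 1 - 5/32 * t := by linarith
    have hP := aux_P ht.1 ht.2
    simp only
    rw [← ENNReal.ofReal_mul (by positivity), ← ENNReal.ofReal_mul (by positivity)]
    congr 1
    have e : 1 + (-K * (54/25 - 9/2 * t + 95/32 * t^2 - 525/256 * t^3 + 4125/4096 * t^4
        + 125/4096 * t^5) * t ^ (-(3/2) : ℝ) * (1 - t)⁻¹ * (1 - 5/32 * t) ^ (-(5/2) : ℝ)) ^ 2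
        = (6^6/10^5) * (((1 - 25/18 * t + 125/288 * t^2 + 625/2304 * t^3) ^ (3:ℝ) * t ^ (-3 : ℝ)) *
          ((1 - t) ^ (-2 : ℝ) * (1 - 5/32 * t) ^ (-5 : ℝ))) := by
      rw [mul_pow, mul_pow, mul_pow, mul_pow, ← Real.rpow_mul_natCast h0.le,
        ← Real.rpow_mul_natCast h2.le, neg_sq, hK]
      have r0 : t ^ (-(3/2) * ((2:ℕ):ℝ) : ℝ) = (t^3)⁻¹ := by
        rw [← Real.rpow_natCast, ← Real.rpow_neg h0.le]; norm_num
      have r1 : t ^ (-3 : ℝ) = (t^3)⁻¹ := by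
        rw [← Real.rpow_natCast, ← Real.rpow_neg h0.le]; norm_num
      have r2 : (1 - 5/32 * t) ^ (-(5/2) * ((2:ℕ):ℝ) : ℝ) = ((1 - 5/32 * t)^5)⁻¹ := by
        rw [← Real.rpow_natCast, ← Real.rpow_neg h2.le]; norm_num
      have r3 : (1 - 5/32 * t) ^ (-5 : ℝ) = ((1 - 5/32 * t)^5)⁻¹ := by
        rw [← Real.rpow_natCast, ← Real.rpow_neg h2.le]; norm_num
      have r4 : (1 - t) ^ (-2 : ℝ) = ((1 - t)^2)⁻¹ := by
        rw [← Real.rpow_natCast, ← Real.rpow_neg h1.le]; norm_num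
      have r5 : (1 - 25/18 * t + 125/288 * t^2 + 625/2304 * t^3) ^ (3:ℝ)
          = (1 - 25/18 * t + 125/288 * t^2 + 625/2304 * t^3) ^ 3 := by
        rw [← Real.rpow_natCast]; norm_num
      rw [r0, r1, r2, r3, r4, r5]
      have i0 : t^3 * (t^3)⁻¹ = 1 := mul_inv_cancel₀ (by positivity)
      have i1 : (1-t)^2 * ((1-t)^2)⁻¹ = 1 := mul_inv_cancel₀ (by positivity)
      have i2 : (1 - 5/32 * t)^5 * ((1 - 5/32 * t)^5)⁻¹ = 1 := mul_inv_cancel₀ (by positivity)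
      rw [inv_pow]
      have : (1:ℝ) = (t^3 * (t^3)⁻¹) * ((1-t)^2 * ((1-t)^2)⁻¹) *
        ((1 - 5/32 * t)^5 * ((1 - 5/32 * t)^5)⁻¹) := by rw [i0, i1, i2]; norm_num
      nth_rewrite 1 [this]
      clear this i0 i1 i2
      generalize (t^3)⁻¹ = X
      generalize ((1-t)^2)⁻¹ = Y
      generalize ((1 - 5/32 * t)^5)⁻¹ = Z
      ring
    rw [e]
    generalize (1 - 25/18 * t + 125/288 * t^2 + 625/2304 * t^3) = P at *
    rw [Real.mul_rpow (by norm_num) (by positivity), Real.mul_rpow (by positivity) (by positivity),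
      Real.mul_rpow (by positivity) (by positivity), Real.mul_rpow (by positivity) (by positivity),
      ← Real.rpow_mul h0.le, ← Real.rpow_mul h1.le, ← Real.rpow_mul h2.le, ← Real.rpow_mul hP.le]
    have f0 : t ^ (-(1/2) : ℝ) = t ^ (-(5/2) : ℝ) * t ^ ((-3) * (-(2/3)) : ℝ) := by
      rw [← Real.rpow_add h0]; norm_num
    have f1 : (1 - t) ^ (-(2/3) : ℝ) = ((1 - t)^2)⁻¹ * (1 - t) ^ ((-2) * (-(2/3)) : ℝ) := by
      rw [← Real.rpow_natCast, ← Real.rpow_neg h1.le, ← Real.rpow_add h1]; norm_num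
    have f2 : (1 - 5/32 * t) ^ (-(1/6) : ℝ) = (1 - 5/32 * t) ^ (-(7/2) : ℝ) *
        (1 - 5/32 * t) ^ ((-5) * (-(2/3)) : ℝ) := by
      rw [← Real.rpow_add h2]; norm_num
    have f3 : P ^ 2 * P ^ (3 * (-(2/3)) : ℝ) = 1 := by
      rw [← Real.rpow_natCast, ← Real.rpow_add hP]; norm_num
    rw [f0, f1, f2]
    generalize t ^ ((-3) * (-(2/3)) : ℝ) = A1
    generalize (1 - t) ^ ((-2) * (-(2/3)) : ℝ) = A2
    generalize (1 - 5/32 * t) ^ ((-5) * (-(2/3)) : ℝ) = A3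
    generalize (1 - 5/32 * t) ^ (-(7/2) : ℝ) = A4
    generalize t ^ (-(5/2) : ℝ) = A5
    generalize ((1 - t)^2)⁻¹ = A6
    generalize ((6^6/10^5 : ℝ)) ^ (-(2/3) : ℝ) = A7
    linear_combination (81/25 * K * A1 * A2 * A3 * A4 * A5 * A6 * A7) * f3
  · intro t ht
    have h0 := ht.1
    have h1 : 0 < 1 - t := by linarith [ht.2]
    have h2 : 0 < 1 - 5/32 * t := by linarith
    have d1 : HasDerivAt (fun y : ℝ => y ^ (-(3/2) : ℝ)) (-(3/2) * t ^ (-(5/2) : ℝ)) t := by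
      convert! Real.hasDerivAt_rpow_const (p := -(3/2)) (Or.inl h0.ne') using 2
      norm_num
    have d2 : HasDerivAt (fun y : ℝ => (1 - 5/32 * y) ^ (-(5/2) : ℝ))
        (-(5/32) * (-(5/2)) * (1 - 5/32 * t) ^ (-(7/2) : ℝ)) t := by
      convert! (((hasDerivAt_id t).const_mul (5/32)).const_sub 1).rpow_const (p := -(5/2)) (Or.inl h2.ne') using 2
      · norm_num
      · norm_num
    have d3 : HasDerivAt (fun y : ℝ => (1 - y)⁻¹) (((1 - t)^2)⁻¹) t := by
      convert! ((hasDerivAt_id t).const_sub 1).inv h1.ne' using 1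
      simp
    have d4 : HasDerivAt (fun t : ℝ => -K * (54/25 - 9/2 * t + 95/32 * t^2 - 525/256 * t^3
        + 4125/4096 * t^4 + 125/4096 * t^5))
        (-K * (- 9/2 + 95/16 * t - 1575/256 * t^2 + 4125/1024 * t^3 + 625/4096 * t^4)) t := by
      have := (((((((hasDerivAt_id t).const_mul (9/2)).const_sub (54/25)).add
        ((hasDerivAt_pow 2 t).const_mul (95/32))).sub ((hasDerivAt_pow 3 t).const_mul (525/256))).add
        ((hasDerivAt_pow 4 t).const_mul (4125/4096))).add
        ((hasDerivAt_pow 5 t).const_mul (125/4096))).const_mul (-K)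
      convert! this using 1
      push_cast
      ring
    convert! ((d4.mul d1).mul d3).mul d2 using 1
    simp only [Pi.mul_apply]
    have g0 : t ^ (-(3/2) : ℝ) = t * t ^ (-(5/2) : ℝ) := by
      rw [← Real.rpow_one_add' h0.le (by norm_num)]; norm_num
    have g2 : (1 - 5/32 * t) ^ (-(5/2) : ℝ) = (1 - 5/32 * t) * (1 - 5/32 * t) ^ (-(7/2) : ℝ) := by
      rw [← Real.rpow_one_add' h2.le (by norm_num)]; norm_num
    have g1 : (1 - t)⁻¹ = (1 - t) * ((1 - t)^2)⁻¹ := by field_simp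
    rw [g0, g1, g2]
    generalize (1 - 5/32 * t) ^ (-(7/2) : ℝ) = A4
    generalize t ^ (-(5/2) : ℝ) = A5
    generalize ((1 - t)^2)⁻¹ = A6
    ring
  · intro t ht
    have h0 := ht.1
    have h1 : 0 < 1 - t := by linarith [ht.2]
    have h2 : 0 < 1 - 5/32 * t := by linarith
    have hP := aux_P ht.1 ht.2
    positivity
  · have c : Tendsto (fun t : ℝ => -K * (54/25 - 9/2 * t + 95/32 * t^2 - 525/256 * t^3
        + 4125/4096 * t^4 + 125/4096 * t^5) * (1 - t)⁻¹ * (1 - 5/32 * t) ^ (-(5/2) : ℝ)) (𝓝[>] 0)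
        (𝓝 (-K * (54/25 - 9/2 * 0 + 95/32 * 0^2 - 525/256 * 0^3
        + 4125/4096 * 0^4 + 125/4096 * 0^5) * (1 - 0)⁻¹ * (1 - 5/32 * 0) ^ (-(5/2) : ℝ))) := by
      apply Tendsto.mono_left _ nhdsWithin_le_nhds
      apply ContinuousAt.tendsto (f := fun t : ℝ => -K * (54/25 - 9/2 * t + 95/32 * t^2 - 525/256 * t^3
        + 4125/4096 * t^4 + 125/4096 * t^5) * (1 - t)⁻¹ * (1 - 5/32 * t) ^ (-(5/2) : ℝ))
      fun_prop (disch := norm_num)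
    refine (c.neg_mul_atTop ?_ t0).congr fun y => by ring
    norm_num
    exact hKpos
  · have c : Tendsto (fun t : ℝ => -K * (54/25 - 9/2 * t + 95/32 * t^2 - 525/256 * t^3
        + 4125/4096 * t^4 + 125/4096 * t^5) * t ^ (-(3/2) : ℝ) * (1 - 5/32 * t) ^ (-(5/2) : ℝ)) (𝓝[<] 1)
        (𝓝 (-K * (54/25 - 9/2 * 1 + 95/32 * 1^2 - 525/256 * 1^3
        + 4125/4096 * 1^4 + 125/4096 * 1^5) * 1 ^ (-(3/2) : ℝ) * (1 - 5/32 * 1) ^ (-(5/2) : ℝ))) := by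
      apply Tendsto.mono_left _ nhdsWithin_le_nhds
      apply ContinuousAt.tendsto (f := fun t : ℝ => -K * (54/25 - 9/2 * t + 95/32 * t^2 - 525/256 * t^3
        + 4125/4096 * t^4 + 125/4096 * t^5) * t ^ (-(3/2) : ℝ) * (1 - 5/32 * t) ^ (-(5/2) : ℝ))
      fun_prop (disch := norm_num)
    refine (c.pos_mul_atTop ?_ t1).congr fun y => by ring
    have : (0:ℝ) < (1 - 5/32 * 1) ^ (-(5/2) : ℝ) := by apply Real.rpow_pos_of_pos; norm_num
    apply mul_pos _ this
    rw [Real.one_rpow]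
    linarith

lemma aux_const : (81/25 * (√10)⁻¹ * (6^6/10^5) ^ (-(2/3) : ℝ))
    * ((2/5) * (2:ℝ) ^ ((1:ℝ)/6) * (5:ℝ) ^ ((1:ℝ)/6)) = 1 := by
  have e1 : (2:ℝ) ^ ((1:ℝ)/6) * (5:ℝ) ^ ((1:ℝ)/6) = 10 ^ ((1:ℝ)/6) := by
    rw [← Real.mul_rpow (by norm_num) (by norm_num)]; norm_num
  have e2 : (√10)⁻¹ = (10:ℝ) ^ (-(1/2) : ℝ) := by
    rw [Real.sqrt_eq_rpow, ← Real.rpow_neg (by norm_num)]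
  have e3 : (6^6/10^5 : ℝ) ^ (-(2/3) : ℝ) = (1/1296) * 10 ^ (10/3 : ℝ) := by
    rw [show (6^6/10^5 : ℝ) = 6 ^ (6:ℝ) * 10 ^ (-5:ℝ) by norm_num [Real.rpow_neg],
      Real.mul_rpow (by positivity) (by positivity), ← Real.rpow_mul (by norm_num),
      ← Real.rpow_mul (by norm_num)]
    norm_num [Real.rpow_neg]
  have e4 : (10:ℝ) ^ (-(1/2) : ℝ) * 10 ^ (10/3 : ℝ) * 10 ^ ((1:ℝ)/6) = 1000 := by
    rw [← Real.rpow_add (by norm_num), ← Real.rpow_add (by norm_num)]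
    norm_num
  rw [e2, e3, mul_assoc (2/5 : ℝ), e1]
  linear_combination (81/25 * (1/1296) * (2/5)) * e4

theorem stmt4 : twoFone (1/6) (1/2) (5/6) (5/32) = (2/5) * (2:ℝ) ^ ((1:ℝ)/6) * Real.sqrt 3 * (5:ℝ) ^ ((1:ℝ)/6) := by
  have hm := aux_main
  rw [← aux_series, aux_japan, aux_gamma] at hm
  have hB : 0 < beta (1/2) (1/3) := beta_pos (by norm_num) (by norm_num)
  have hC := aux_const
  have hCpos : 0 < (81/25 * (√10)⁻¹ * (6^6/10^5) ^ (-(2/3) : ℝ)) := by positivity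
  generalize (81/25 * (√10)⁻¹ * (6^6/10^5) ^ (-(2/3) : ℝ)) = C at *
  have hR := congrArg ENNReal.toReal hm
  rw [ENNReal.toReal_mul, ENNReal.toReal_mul, ENNReal.tsum_toReal_eq (fun n => ENNReal.ofReal_ne_top),
    ENNReal.toReal_ofReal (by positivity), ENNReal.toReal_ofReal (by positivity),
    ENNReal.toReal_ofReal (by positivity)] at hR
  have hT : (∑' n : ℕ, (ENNReal.ofReal
      (poch (1/6) n * poch (1/2) n / (poch (5/6) n * (n.factorial : ℝ)) * (5/32) ^ n)).toReal)
      = twoFone (1/6) (1/2) (5/6) (5/32) := by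
    unfold twoFone
    apply tsum_congr
    intro n
    have := poch_pos' (show (0:ℝ) < 1/6 by norm_num) n
    have := poch_pos' (show (0:ℝ) < 1/2 by norm_num) n
    have := poch_pos' (show (0:ℝ) < 5/6 by norm_num) n
    rw [ENNReal.toReal_ofReal (by positivity)]
  rw [hT] at hR
  apply mul_left_cancel₀ hCpos.ne'
  apply mul_right_cancel₀ hB.ne'
  linear_combination -hR - √3 * beta (1/2) (1/3) * hC
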